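/- Suppose F ∈ 𝓔^m is essentially smooth. Let C_A be a closed convex set of A-components and C_B a closed convex set of B-components. Let S_n ∈ S^m, let L̂ minimize L ↦ F*(L) − ⟨L, S_n⟩ over {L ∈ 𝕃^m_+ : L_B ∈ C_B}, and let Σ̌ minimize Σ ↦ F(Σ) − ⟨L̂, Σ⟩ over {Σ ∈ S^m_+ : Σ_A ∈ C_A}. Assume both minimizers exist and that L̂ and Ľ := ∇F(Σ̌) lie in 𝕃^m_+. Then Ľ_B = L̂_B ∈ C_B ∩ (𝕃^m_+)_B; in particular Σ̌ satisfies both Σ̌_A ∈ C_A and (∇F(Σ̌))_B ∈ C_B. -/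

import Mathlib

open Matrix Filter Topology

namespace Entropic

abbrev Mat (m : ℕ) := Matrix (Fin m) (Fin m) ℝ

variable {m : ℕ}

/-- The trace inner product `⟨A,B⟩ = tr(AB)` on matrices. -/
noncomputable def ip (A B : Mat m) : ℝ := (A * B).trace

/-- The Frobenius norm `‖A‖_F = √tr(AAᵀ)`. -/
noncomputable def fnorm (A : Mat m) : ℝ := Real.sqrt (ip A Aᵀ)

/-- The class `𝓔^m`: proper convex lower semicontinuous `F : S^m → ℝ ∪ {+∞}` with
`S^m_+ ⊆ dom F ⊆ cl(S^m_+)` which is strictly convex and continuously differentiable on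
`S^m_+`; the (trace-inner-product) gradient on `S^m_+` is bundled as `grad`. -/
structure EClass (m : ℕ) where
  F : Mat m → EReal
  grad : Mat m → Mat m
  F_ne_bot : ∀ A : Mat m, F A ≠ ⊥
  convex : ∀ x y : Mat m, x.IsHermitian → y.IsHermitian → ∀ a b : ℝ,
    0 ≤ a → 0 ≤ b → a + b = 1 →
    F (a • x + b • y) ≤ (a : EReal) * F x + (b : EReal) * F y
  lsc : LowerSemicontinuousOn F {A : Mat m | A.IsHermitian}
  posDef_mem_dom : ∀ A : Mat m, A.PosDef → F A ≠ ⊤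
  dom_subset_psd : ∀ A : Mat m, F A ≠ ⊤ → A.PosSemidef
  strictConvex : ∀ x y : Mat m, x.PosDef → y.PosDef → x ≠ y → ∀ a b : ℝ,
    0 < a → 0 < b → a + b = 1 →
    F (a • x + b • y) < (a : EReal) * F x + (b : EReal) * F y
  grad_isHermitian : ∀ P : Mat m, P.PosDef → (grad P).IsHermitian
  hasGradAt : ∀ P : Mat m, P.PosDef → ∀ H : Mat m, H.IsHermitian →
    HasDerivAt (fun t : ℝ => (F (P + t • H)).toReal) (ip (grad P) H) 0
  grad_continuousOn : ContinuousOn grad {A : Mat m | A.PosDef}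

/-- `𝕃^m_+ = ∇F(S^m_+)`. -/
def Lplus (E : EClass m) : Set (Mat m) := E.grad '' {A : Mat m | A.PosDef}

/-- The Fenchel conjugate `F*(L) = sup_{Σ ∈ S^m} (⟨Σ,L⟩ − F(Σ))`. -/
noncomputable def conj (E : EClass m) (L : Mat m) : EReal :=
  ⨆ S : {A : Mat m // A.IsHermitian}, ((ip (S : Mat m) L : EReal) - E.F (S : Mat m))

/-- `g_n(L) = −F*(L) + ⟨L, S_n⟩`. -/
noncomputable def gn (E : EClass m) (Sn L : Mat m) : EReal :=
  -(conj E L) + (ip L Sn : EReal)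

/-- A set `U ⊆ S^m` is (relatively) open in `S^m`. -/
def RelOpen (U : Set (Mat m)) : Prop :=
  U ⊆ {A : Mat m | A.IsHermitian} ∧
    ∀ L ∈ U, ∃ ε > 0, ∀ M : Mat m, M.IsHermitian → fnorm (M - L) < ε → M ∈ U

/-- The affine subspace `A₀ + V` of `S^m`. -/
def affSet (A0 : Mat m) (V : Submodule ℝ (Mat m)) : Set (Mat m) :=
  {L : Mat m | L - A0 ∈ V}

/-- The orthogonal complement in `S^m` (w.r.t. the trace inner product) of the linear
subspace `V`. -/
def perp (V : Submodule ℝ (Mat m)) : Set (Mat m) :=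
  {W : Mat m | W.IsHermitian ∧ ∀ U ∈ V, ip W U = 0}


/-- `F ∈ 𝓔^m` is essentially smooth. -/
def EssSmooth {m : ℕ} (E : EClass m) : Prop :=
  ∀ (P : ℕ → Mat m) (B : Mat m), (∀ k, (P k).PosDef) → Tendsto P atTop (𝓝 B) →
    B.PosSemidef → ¬ B.PosDef → Tendsto (fun k => fnorm (E.grad (P k))) atTop atTop

/-- The component of a symmetric matrix corresponding to a set `s` of entry positions:
entries outside `s` are replaced by `0`. -/
noncomputable def comp {m : ℕ} (s : Set (Fin m × Fin m)) (P : Mat m) : Mat m :=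
  fun i j => s.indicator (fun q => P q.1 q.2) (i, j)

/-- Positive definiteness is preserved under small symmetric perturbations. -/
lemma eventually_posDef_add_smul {m : ℕ} {P H : Mat m} (hP : P.PosDef) (hH : H.IsHermitian) :
    ∀ᶠ t : ℝ in 𝓝 0, (P + t • H).PosDef := by
  have hcont : Continuous fun z : ℝ × (Fin m → ℝ) =>
      z.2 ⬝ᵥ ((P + z.1 • H) *ᵥ z.2) := by fun_prop
  have hsphere : ∀ᶠ t : ℝ in 𝓝 0, ∀ x ∈ Metric.sphere (0 : Fin m → ℝ) 1,
      0 < x ⬝ᵥ ((P + t • H) *ᵥ x) := by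
    refine (isCompact_sphere (0 : Fin m → ℝ) 1).eventually_forall_of_forall_eventually
      fun x hx => ?_
    have hx0 : x ≠ 0 := ne_zero_of_mem_unit_sphere ⟨x, hx⟩
    exact hcont.continuousAt.eventually_const_lt (by simpa using hP.dotProduct_mulVec_pos hx0)
  filter_upwards [hsphere] with t ht
  refine PosDef.of_dotProduct_mulVec_pos
    (hP.isHermitian.add (hH.smul (IsSelfAdjoint.all t))) fun x hx => ?_
  have hpos := ht (‖x‖⁻¹ • x) (by simp [norm_smul, hx])
  rw [mulVec_smul, smul_dotProduct, dotProduct_smul, smul_smul, smul_eq_mul] at hpos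
  exact pos_of_mul_pos_right hpos (by positivity)

lemma ip_add_right {m : ℕ} (A B C : Mat m) : ip A (B + C) = ip A B + ip A C := by
  simp [ip, mul_add]

lemma ip_smul_right {m : ℕ} (A B : Mat m) (t : ℝ) : ip A (t • B) = t * ip A B := by
  simp [ip]

lemma ip_sub_left {m : ℕ} (A B C : Mat m) : ip (A - B) C = ip A C - ip B C := by
  simp [ip, sub_mul]

lemma comp_isHermitian {m : ℕ} {s : Set (Fin m × Fin m)}
    (hs : ∀ i j : Fin m, (i, j) ∈ s ↔ (j, i) ∈ s) {P : Mat m} (hP : P.IsHermitian) :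
    (comp s P).IsHermitian := by
  classical
  refine IsHermitian.ext fun i j => ?_
  have hij : P j i = P i j := by simpa using hP.apply i j
  simp [comp, Set.indicator_apply, hs j i, hij]

/-- A symmetric matrix orthogonal to its own component at the positions in `s` vanishes there. -/
lemma comp_eq_zero_of_ip_comp_eq_zero {m : ℕ} {s : Set (Fin m × Fin m)} {P : Mat m}
    (hP : P.IsHermitian) (h : ip P (comp s P) = 0) : comp s P = 0 := by
  classical
  have hterm : ∀ i j, 0 ≤ P i j * comp s P j i := fun i j => by
    have hij : P j i = P i j := by simpa using hP.apply i j
    by_cases hmem : (j, i) ∈ s <;> simp [comp, hmem, hij, mul_self_nonneg]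
  have hsum : ∑ i, ∑ j, P i j * comp s P j i = 0 := by
    simpa [ip, trace, mul_apply] using h
  ext j i
  have hzero := (Finset.sum_eq_zero_iff_of_nonneg fun j _ => hterm i j).1
    ((Finset.sum_eq_zero_iff_of_nonneg fun i _ => Finset.sum_nonneg fun j _ => hterm i j).1
      hsum i (Finset.mem_univ i)) j (Finset.mem_univ j)
  have hij : P j i = P i j := by simpa using hP.apply i j
  by_cases hmem : (j, i) ∈ s
  · simpa [comp, hmem, hij] using hzero
  · simp [comp, hmem]

/-- At a minimizer of `Q ↦ F(Q) - ⟨L,Q⟩` over a set of positive definite matrices, the gradient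
agrees with `L` along every symmetric direction that is locally feasible. -/
lemma ip_grad_eq_of_isMinOn {m : ℕ} (E : EClass m) {L P H : Mat m} {S : Set (Mat m)}
    (hP : P.PosDef) (hH : H.IsHermitian)
    (hmin : IsMinOn (fun Q : Mat m => E.F Q - (ip L Q : EReal)) S P)
    (hS : ∀ᶠ t : ℝ in 𝓝 0, P + t • H ∈ S) : ip (E.grad P) H = ip L H := by
  have hderiv : HasDerivAt (fun t : ℝ => (E.F (P + t • H)).toReal - ip L (P + t • H))
      (ip (E.grad P) H - ip L H) 0 := by
    refine (E.hasGradAt P hP H hH).sub ?_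
    simp_rw [ip_add_right, ip_smul_right]
    simpa using ((hasDerivAt_id (0 : ℝ)).mul_const (ip L H)).const_add (ip L P)
  have hreal : ∀ Q : Mat m, Q.PosDef →
      E.F Q - (ip L Q : EReal) = (((E.F Q).toReal - ip L Q : ℝ) : EReal) := fun Q hQ => by
    rw [EReal.coe_sub, EReal.coe_toReal (E.posDef_mem_dom Q hQ) (E.F_ne_bot Q)]
  have hloc : IsLocalMin (fun t : ℝ => (E.F (P + t • H)).toReal - ip L (P + t • H)) 0 := by
    filter_upwards [hS, eventually_posDef_add_smul hP hH] with t htS htP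
    have hle := isMinOn_iff.1 hmin _ htS
    rw [hreal P hP, hreal _ htP, EReal.coe_le_coe_iff] at hle
    simpa using hle
  exact sub_eq_zero.1 (hloc.hasDerivAt_eq_zero hderiv)

/-- two-step estimation, Proposition `prop:2step`. Suppose `F ∈ 𝓔^m` is
essentially smooth; fix a symmetric set `s` of entry positions (the `A`-entries, whose
complement gives the `B`-entries), closed convex sets `C_A` of `A`-components and `C_B` of
`B`-components, and `S_n ∈ S^m`. If `L̂` minimizes `L ↦ F*(L) − ⟨L,S_n⟩` over
`{L ∈ 𝕃^m_+ : L_B ∈ C_B}` and `Σ̌` minimizes `Σ ↦ F(Σ) − ⟨L̂,Σ⟩` over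
`{Σ ∈ S^m_+ : Σ_A ∈ C_A}`, with `L̂, Ľ := ∇F(Σ̌) ∈ 𝕃^m_+`, then
`Ľ_B = L̂_B ∈ C_B ∩ (𝕃^m_+)_B`; in particular `Σ̌_A ∈ C_A` and `(∇F(Σ̌))_B ∈ C_B`. -/
theorem two_step_estimator {m : ℕ} (E : EClass m) (hess : EssSmooth E)
    (s : Set (Fin m × Fin m)) (hs : ∀ i j : Fin m, (i, j) ∈ s ↔ (j, i) ∈ s)
    (CA CB : Set (Mat m))
    (hCAconv : Convex ℝ CA) (hCAclosed : IsClosed CA) (hCAcomp : ∀ X ∈ CA, comp s X = X)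
    (hCBconv : Convex ℝ CB) (hCBclosed : IsClosed CB) (hCBcomp : ∀ X ∈ CB, comp sᶜ X = X)
    (Sn : Mat m) (hSn : Sn.IsHermitian)
    (Lhat : Mat m) (hLhatmem : Lhat ∈ {L ∈ Lplus E | comp sᶜ L ∈ CB})
    (hLhatmin : IsMinOn (fun L : Mat m => conj E L - (ip L Sn : EReal))
      {L ∈ Lplus E | comp sᶜ L ∈ CB} Lhat)
    (Schk : Mat m) (hSchkmem : Schk ∈ {Q : Mat m | Q.PosDef ∧ comp s Q ∈ CA})
    (hSchkmin : IsMinOn (fun Q : Mat m => E.F Q - (ip Lhat Q : EReal))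
      {Q : Mat m | Q.PosDef ∧ comp s Q ∈ CA} Schk)
    (hLhatLplus : Lhat ∈ Lplus E) (hLchkLplus : E.grad Schk ∈ Lplus E) :
    comp sᶜ (E.grad Schk) = comp sᶜ Lhat ∧
      comp sᶜ Lhat ∈ CB ∧ comp sᶜ Lhat ∈ comp sᶜ '' Lplus E ∧
      comp s Schk ∈ CA ∧ comp sᶜ (E.grad Schk) ∈ CB := by
  obtain ⟨hPos, hA⟩ := hSchkmem
  have hLhat : Lhat.IsHermitian := by
    obtain ⟨P, hP, rfl⟩ := hLhatLplus
    exact E.grad_isHermitian P hP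
  have hDiff : (E.grad Schk - Lhat).IsHermitian := (E.grad_isHermitian Schk hPos).sub hLhat
  have hH : (comp sᶜ (E.grad Schk - Lhat)).IsHermitian :=
    comp_isHermitian (fun i j => not_congr (hs i j)) hDiff
  have hfeas (t : ℝ) : comp s (Schk + t • comp sᶜ (E.grad Schk - Lhat)) = comp s Schk := by
    ext i j
    by_cases hmem : (i, j) ∈ s <;> simp [comp, hmem]
  have hip := ip_grad_eq_of_isMinOn E hPos hH hSchkmin <| by
    filter_upwards [eventually_posDef_add_smul hPos hH] with t ht
    exact ⟨ht, by rwa [hfeas]⟩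
  have hzero := comp_eq_zero_of_ip_comp_eq_zero hDiff (by rw [ip_sub_left, hip, sub_self])
  have hB : comp sᶜ (E.grad Schk) = comp sᶜ Lhat := by
    ext i j
    have hij := congrFun (congrFun hzero i) j
    by_cases hmem : (i, j) ∈ s
    · simp [comp, hmem]
    · simpa [comp, hmem, sub_eq_zero] using hij
  exact ⟨hB, hLhatmem.2, ⟨Lhat, hLhatLplus, rfl⟩, hA, hB ▸ hLhatmem.2⟩

end Entropic
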